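/- Let C be an abelian category with enough projectives, and let X be a bounded cochain complex over C indexed by ℤ (X^k = 0 for all but finitely many k). Then the following are equivalent: (1) X is perfect, i.e. X is isomorphic in the derived category D(C) to a bounded cochain complex P with every P^k projective; (2) there exists n₀ ∈ ℤ such that for every object M of C and every n ≥ n₀, every morphism in D(C) from X to the n-fold shift of the complex M concentrated in degree 0 is zero (i.e. Ext^n(X, M) = 0 for all n ≥ n₀ and all M in C). -/

import Mathlib

open CategoryTheory CategoryTheory.Limits

namespace CochainComplex

variable {C : Type*} [Category C] [Abelian C]

lemma quasiIsoAt_of_op {K L : CochainComplex C ℤ} (f : K ⟶ L) (n m : ℤ) (hm : n + m = 0)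
    (h : QuasiIsoAt ((opEquivalence C).functor.map f.op) m) : QuasiIsoAt f n := by
  obtain rfl : n = -m := by lia
  rw [quasiIsoAt_iff' _ (m - 1) m (m + 1) (by simp) (by simp)] at h
  rw [quasiIsoAt_iff' _ (-(m + 1)) (-m) (-(m - 1)) (by grind [prev]) (by grind [next]),
    ← ShortComplex.quasiIso_opMap_iff]
  exact h

lemma quasiIso_of_op {K L : CochainComplex C ℤ} (f : K ⟶ L)
    (h : QuasiIso ((opEquivalence C).functor.map f.op)) : QuasiIso f where
  quasiIsoAt n := quasiIsoAt_of_op f n (-n) (by simp) inferInstance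

/-- A bounded above cochain complex in an abelian category with enough projectives receives a
quasi-isomorphism from a bounded above complex of projective objects. -/
lemma exists_quasiIso_projective [EnoughProjectives C] (K : CochainComplex C ℤ) (n : ℤ)
    [K.IsStrictlyLE n] :
    ∃ (P : CochainComplex C ℤ) (p : P ⟶ K), QuasiIso p ∧ (∀ i : ℤ, Projective (P.X i)) ∧
      P.IsStrictlyLE n := by
  let e := opEquivalence C
  let K' : CochainComplex Cᵒᵖ ℤ := e.functor.obj (Opposite.op K)
  have : K'.IsStrictlyGE (-n) := by
    rw [isStrictlyGE_iff]
    intro i hi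
    exact (K.isZero_of_isStrictlyLE n (-i) (by lia)).op
  obtain ⟨I, i, hi, hI, _⟩ := Plus.modelCategoryQuillen.exists_quasiIso_injective K' (-n)
  let P : CochainComplex C ℤ := (e.inverse.obj I).unop
  let p : P ⟶ K := (e.unit.app (Opposite.op K) ≫ e.inverse.map i).unop
  refine ⟨P, p, quasiIso_of_op p ?_, fun k ↦ ?_, ?_⟩
  · have hp : e.functor.map p.op = i ≫ e.counitInv.app I := by
      simp [p]
    change QuasiIso (e.functor.map p.op)
    rw [hp]
    infer_instance
  · change Projective (I.X (-k)).unop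
    have := hI (-k)
    infer_instance
  · rw [isStrictlyLE_iff]
    intro k hk
    exact (I.isZero_of_isStrictlyGE (-n) (-k) (by lia)).unop

section

variable [HasDerivedCategory C]

lemma IsKProjective.exists_Q_map_eq {K L : CochainComplex C ℤ} [K.IsKProjective]
    (f : DerivedCategory.Q.obj K ⟶ DerivedCategory.Q.obj L) :
    ∃ φ : K ⟶ L, DerivedCategory.Q.map φ = f := by
  obtain ⟨g, hg⟩ := (Qh_map_bijective K ((HomotopyCategory.quotient _ _).obj L)).surjective f
  obtain ⟨φ, rfl⟩ := (HomotopyCategory.quotient _ _).map_surjective g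
  exact ⟨φ, hg⟩

lemma IsKProjective.quotient_map_eq_zero {K L : CochainComplex C ℤ} [K.IsKProjective]
    (φ : K ⟶ L) (hφ : DerivedCategory.Q.map φ = 0) :
    (HomotopyCategory.quotient _ _).map φ = 0 := by
  apply (Qh_map_bijective K ((HomotopyCategory.quotient _ _).obj L)).injective
  rw [Functor.map_zero]
  exact hφ

open DerivedCategory

/-- There are no nonzero morphisms in the derived category from a K-projective complex which
vanishes in degree `-n` to the `n`-fold shift of an object. -/
lemma IsKProjective.hom_singleFunctor_shift_eq_zero (P : CochainComplex C ℤ) [P.IsKProjective]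
    (M : C) (n : ℤ) (hn : IsZero (P.X (-n)))
    (f : Q.obj P ⟶ ((DerivedCategory.singleFunctor C 0).obj M)⟦n⟧) : f = 0 := by
  let L := (CochainComplex.singleFunctor C 0).obj M
  let e : Q.obj (L⟦n⟧) ≅ ((DerivedCategory.singleFunctor C 0).obj M)⟦n⟧ :=
    (Q.commShiftIso n).app L
  obtain ⟨φ, hφ⟩ := exists_Q_map_eq (f ≫ e.inv)
  have hφ0 : φ = 0 := by
    ext i
    by_cases hi : i = -n
    · subst hi
      exact hn.eq_of_src _ _
    · have : (L⟦n⟧).IsStrictlyLE (-n) := isStrictlyLE_shift L 0 n (-n) (by simp)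
      have : (L⟦n⟧).IsStrictlyGE (-n) := isStrictlyGE_shift L 0 n (-n) (by simp)
      obtain h | h := lt_or_gt_of_ne hi
      · exact (isZero_of_isStrictlyGE (L⟦n⟧) (-n) i h).eq_of_tgt _ _
      · exact (isZero_of_isStrictlyLE (L⟦n⟧) (-n) i h).eq_of_tgt _ _
  rw [← cancel_mono e.inv, zero_comp, ← hφ, hφ0, Functor.map_zero]

open HomComplex in
/-- If `P` is K-projective and `Ext^n(P, P.opcycles (-n)) = 0`, then `P.opcycles (-n)` is a
direct summand of `P.X (-n + 1)`. -/
lemma IsKProjective.projective_opcycles (P : CochainComplex C ℤ) [P.IsKProjective] (n p q : ℤ)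
    (hp : p + n = 0) (hq : p + 1 = q) [Projective (P.X q)]
    (h : ∀ f : Q.obj P ⟶ ((DerivedCategory.singleFunctor C 0).obj (P.opcycles p))⟦n⟧, f = 0) :
    Projective (P.opcycles p) := by
  let L := (CochainComplex.singleFunctor C 0).obj (P.opcycles p)
  let e : Q.obj (L⟦n⟧) ≅ ((DerivedCategory.singleFunctor C 0).obj (P.opcycles p))⟦n⟧ :=
    (Q.commShiftIso n).app L
  let x : Cocycle P L n := Cocycle.toSingleMk (P.pOpcycles p) hp (p - 1) (by simp) (by simp)
  have hx : Q.map (Cocycle.equivHomShift.symm x) = 0 := by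
    rw [← cancel_mono e.hom, zero_comp]
    exact h _
  have hx' : x ∈ coboundaries P L n := by
    rw [← CohomologyClass.toHom_mk_eq_zero_iff, CohomologyClass.toHom_mk]
    exact quotient_map_eq_zero _ hx
  obtain ⟨g, hg⟩ := (Cocycle.toSingleMk_mem_coboundaries_iff _ hp (p - 1) (by simp)
    (by simp) q hq).1 hx'
  exact Retract.projective (X := P.opcycles p) (Y := P.X q)
    { i := P.fromOpcycles p q
      r := g
      retract := by simp [← cancel_epi (P.pOpcycles p), hg] }

end

lemma projective_truncGE_X (P : CochainComplex C ℤ) (n : ℤ) [∀ i : ℤ, Projective (P.X i)]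
    [Projective (P.opcycles n)] (i : ℤ) : Projective ((P.truncGE n).X i) := by
  obtain h | rfl | h := lt_trichotomy i n
  · exact (isZero_of_isStrictlyGE (P.truncGE n) n i h).projective
  · exact Projective.of_iso (P.truncGEXIsoOpcycles i).symm inferInstance
  · exact Projective.of_iso (P.truncGEXIso n i h).symm inferInstance

lemma exists_isStrictlyGE_isStrictlyLE (X : CochainComplex C ℤ)
    (hX : ∃ s : Finset ℤ, ∀ k ∉ s, IsZero (X.X k)) :
    ∃ a b : ℤ, X.IsStrictlyGE a ∧ X.IsStrictlyLE b := by
  obtain ⟨s, hs⟩ := hX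
  obtain ⟨a, ha⟩ := s.bddBelow
  obtain ⟨b, hb⟩ := s.bddAbove
  refine ⟨a, b, ?_, ?_⟩
  · rw [isStrictlyGE_iff]
    exact fun i hi ↦ hs i fun his ↦ hi.not_ge (ha his)
  · rw [isStrictlyLE_iff]
    exact fun i hi ↦ hs i fun his ↦ hi.not_ge (hb his)

lemma exists_finset_isZero (X : CochainComplex C ℤ) (a b : ℤ) [X.IsStrictlyGE a]
    [X.IsStrictlyLE b] : ∃ s : Finset ℤ, ∀ k ∉ s, IsZero (X.X k) := by
  refine ⟨Finset.Icc a b, fun k hk ↦ ?_⟩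
  rw [Finset.mem_Icc, not_and_or, not_le, not_le] at hk
  obtain h | h := hk
  · exact X.isZero_of_isStrictlyGE a k h
  · exact X.isZero_of_isStrictlyLE b k h

end CochainComplex

open CochainComplex in
/-- A bounded cochain complex `X` over an abelian category with enough projectives is perfect
(isomorphic in the derived category to a bounded complex of projectives) if and only if
`Ext^n(X, M) = 0` for all sufficiently large `n` and all objects `M`. -/
theorem stmt_2 {C : Type*} [Category C] [Abelian C] [EnoughProjectives C]
    [HasDerivedCategory C]
    (X : CochainComplex C ℤ) (hX : ∃ s : Finset ℤ, ∀ k ∉ s, IsZero (X.X k)) :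
    (∃ P : CochainComplex C ℤ, (∀ k : ℤ, Projective (P.X k)) ∧
        (∃ s : Finset ℤ, ∀ k ∉ s, IsZero (P.X k)) ∧
        Nonempty (DerivedCategory.Q.obj X ≅ DerivedCategory.Q.obj P)) ↔
      (∃ n₀ : ℤ, ∀ (M : C) (n : ℤ), n₀ ≤ n →
        ∀ f : DerivedCategory.Q.obj X ⟶ ((DerivedCategory.singleFunctor C 0).obj M)⟦n⟧,
          f = 0) := by
  constructor
  · rintro ⟨P, _, hP, ⟨e⟩⟩
    obtain ⟨a, b, _, _⟩ := exists_isStrictlyGE_isStrictlyLE P hP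
    have : P.IsKProjective := isKProjective_of_projective P b
    refine ⟨-a + 1, fun M n hn f ↦ ?_⟩
    rw [← cancel_epi e.inv, comp_zero]
    exact IsKProjective.hom_singleFunctor_shift_eq_zero P M n
      (P.isZero_of_isStrictlyGE a (-n) (by lia)) _
  · rintro ⟨n₀, h⟩
    obtain ⟨a, b, _, _⟩ := exists_isStrictlyGE_isStrictlyLE X hX
    obtain ⟨P, p, _, _, _⟩ := exists_quasiIso_projective X b
    have : P.IsKProjective := isKProjective_of_projective P b
    have : IsIso (DerivedCategory.Q.map p) := by
      rwa [DerivedCategory.isIso_Q_map_iff_quasiIso]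
    let m := min a (-n₀)
    have : P.IsGE m := by
      rw [isGE_iff]
      intro i hi
      rw [exactAt_iff_of_quasiIsoAt p i]
      exact X.exactAt_of_isGE a i (by lia)
    have : Projective (P.opcycles m) := by
      refine IsKProjective.projective_opcycles P (-m) m (m + 1) (by simp) rfl fun f ↦ ?_
      rw [← cancel_epi (inv (DerivedCategory.Q.map p)), comp_zero]
      exact h _ _ (by lia) _
    have : IsIso (DerivedCategory.Q.map (P.πTruncGE m)) := by
      rw [DerivedCategory.isIso_Q_map_iff_quasiIso]
      infer_instance
    exact ⟨P.truncGE m, projective_truncGE_X P m, exists_finset_isZero _ m b,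
      ⟨(asIso (DerivedCategory.Q.map p)).symm ≪≫
        asIso (DerivedCategory.Q.map (P.πTruncGE m))⟩⟩
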